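/- Let M be a positive integer. The map q ↦ (β_i), where (β_i) denotes the greedy expansion of 1 in base q (with the convention (β_i) = 10^∞ for q = 1, i.e., β_1 = 1 and β_i = 0 for i > 1), is a strictly increasing one-to-one correspondence between the interval [1, M+1] and the set of all sequences (β_i) with digits in {0,...,M} satisfying β_{n+1}β_{n+2}... < β_1β_2... (strict lexicographic inequality) whenever β_n < M. -/

import Mathlib

/-- Strict lexicographic order on digit sequences (indexed from 0). -/
def LexLt (a b : ℕ → ℕ) : Prop :=
  ∃ n, (∀ k, k < n → a k = b k) ∧ a n < b n

/-- Non-strict lexicographic order on digit sequences. -/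
def LexLe (a b : ℕ → ℕ) : Prop :=
  LexLt a b ∨ a = b

open Classical in
/-- The next greedy digit: the largest integer `m ≤ M` with `s + m / q ^ (n+1) ≤ x`,
where `s` is the value of the previously chosen digits. -/
noncomputable def gDigit (M : ℕ) (q x s : ℝ) (n : ℕ) : ℕ :=
  Nat.findGreatest (fun m => s + (m : ℝ) / q ^ (n + 1) ≤ x) M

/-- Partial sums of the greedy expansion of `x` in base `q` with digits `≤ M`. -/
noncomputable def gSum (M : ℕ) (q x : ℝ) : ℕ → ℝ
  | 0 => 0
  | n + 1 => gSum M q x n + (gDigit M q x (gSum M q x n) n : ℝ) / q ^ (n + 1)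

/-- `greedy M q x n` is the `(n+1)`-st digit (indexing from 0) of the greedy expansion
of `x` in base `q` with digits in `{0, ..., M}`: recursively, it is the largest
integer `b_n ≤ M` with `b_1/q + ⋯ + b_n/q^n ≤ x`. -/
noncomputable def greedy (M : ℕ) (q x : ℝ) (n : ℕ) : ℕ :=
  gDigit M q x (gSum M q x n) n

/-- The greedy expansion of `1` in base `q`, with the convention `(β_i) = 10^∞` for `q = 1`. -/
noncomputable def greedyOne (M : ℕ) (q : ℝ) (n : ℕ) : ℕ :=
  if q = 1 then (if n = 0 then 1 else 0) else greedy M q 1 n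

open Filter Topology

theorem lexLt_irrefl (a : ℕ → ℕ) : ¬ LexLt a a := fun ⟨_, _, h⟩ => lt_irrefl _ h

theorem lexLt_trichotomy (a b : ℕ → ℕ) : LexLt a b ∨ a = b ∨ LexLt b a := by
  classical
  by_cases h : a = b
  · exact Or.inr (Or.inl h)
  · have hex : ∃ n, a n ≠ b n := Function.ne_iff.mp h
    have hmin : ∀ k, k < Nat.find hex → a k = b k := fun k hk =>
      not_not.mp (Nat.find_min hex hk)
    rcases lt_or_gt_of_ne (Nat.find_spec hex) with hlt | hlt
    · exact Or.inl ⟨_, hmin, hlt⟩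
    · exact Or.inr (Or.inr ⟨_, fun k hk => (hmin k hk).symm, hlt⟩)

/-- The value in base `q` of the first `n` digits of `c`. -/
noncomputable def digitSum (q : ℝ) (c : ℕ → ℕ) (n : ℕ) : ℝ :=
  ∑ i ∈ Finset.range n, (c i : ℝ) / q ^ (i + 1)

theorem digitSum_zero (q : ℝ) (c : ℕ → ℕ) : digitSum q c 0 = 0 := Finset.sum_range_zero _

theorem digitSum_succ (q : ℝ) (c : ℕ → ℕ) (n : ℕ) :
    digitSum q c (n + 1) = digitSum q c n + (c n : ℝ) / q ^ (n + 1) :=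
  Finset.sum_range_succ _ _

theorem digitSum_congr {q : ℝ} {c d : ℕ → ℕ} {n : ℕ} (h : ∀ k, k < n → c k = d k) :
    digitSum q c n = digitSum q d n :=
  Finset.sum_congr rfl fun i hi => by rw [h i (Finset.mem_range.mp hi)]

theorem digitSum_mono {q : ℝ} (hq : 0 < q) (c : ℕ → ℕ) : Monotone (digitSum q c) :=
  monotone_nat_of_le_succ fun n => by
    rw [digitSum_succ]
    have : 0 ≤ (c n : ℝ) / q ^ (n + 1) := by positivity
    linarith

theorem digitSum_add {q : ℝ} (c : ℕ → ℕ) (n k : ℕ) :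
    digitSum q c (n + k) = digitSum q c n + digitSum q (fun i => c (n + i)) k / q ^ n := by
  unfold digitSum
  rw [Finset.sum_range_add, Finset.sum_div]
  congr 1
  refine Finset.sum_congr rfl fun i _ => ?_
  rw [div_div]
  congr 1
  ring

theorem digitSum_add_gap_le {q q' : ℝ} (hq : 0 < q) (h : q ≤ q') (c : ℕ → ℕ) (n : ℕ) :
    digitSum q' c (n + 1) + ((c 0 : ℝ) / q - (c 0 : ℝ) / q') ≤ digitSum q c (n + 1) := by
  induction n with
  | zero => simp [digitSum]
  | succ n ih =>
    rw [digitSum_succ q', digitSum_succ q c (n + 1)]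
    have : (c (n + 1) : ℝ) / q' ^ (n + 1 + 1) ≤ (c (n + 1) : ℝ) / q ^ (n + 1 + 1) := by gcongr
    linarith

/-- The sequence `β` satisfies the inequalities that characterize the greedy expansion
of `1` in base `q`. -/
structure IsGreedyOne (M : ℕ) (q : ℝ) (β : ℕ → ℕ) : Prop where
  digit_le : ∀ n, β n ≤ M
  digitSum_le : ∀ n, digitSum q β n ≤ 1
  one_lt : ∀ n, β n < M → 1 < digitSum q β n + ((β n : ℝ) + 1) / q ^ (n + 1)

theorem gSum_eq_digitSum (M : ℕ) (q x : ℝ) (n : ℕ) :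
    gSum M q x n = digitSum q (greedy M q x) n := by
  induction n with
  | zero => rw [digitSum_zero]; rfl
  | succ n ih => rw [digitSum_succ, ← ih]; rfl

theorem gSum_le (M : ℕ) (q : ℝ) {x : ℝ} (hx : 0 ≤ x) (n : ℕ) : gSum M q x n ≤ x := by
  classical
  induction n with
  | zero => exact hx
  | succ n ih =>
    exact Nat.findGreatest_spec
      (P := fun m : ℕ => gSum M q x n + (m : ℝ) / q ^ (n + 1) ≤ x) (m := 0) (Nat.zero_le M)
      (by simpa using ih)

theorem isGreedyOne_greedy (M : ℕ) (q : ℝ) : IsGreedyOne M q (greedy M q 1) where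
  digit_le n := Nat.findGreatest_le _
  digitSum_le n := gSum_eq_digitSum M q 1 n ▸ gSum_le M q zero_le_one n
  one_lt n hn := by
    classical
    have h := Nat.findGreatest_is_greatest
      (P := fun m : ℕ => gSum M q 1 n + (m : ℝ) / q ^ (n + 1) ≤ 1)
      (n := M) (k := greedy M q 1 n + 1) (Nat.lt_succ_self _) hn
    rw [← gSum_eq_digitSum]
    push_cast at h
    exact not_le.mp h

theorem IsGreedyOne.eq_greedy {M : ℕ} {q : ℝ} {β : ℕ → ℕ} (hq : 0 < q)
    (h : IsGreedyOne M q β) : greedy M q 1 = β := by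
  classical
  funext n
  induction n using Nat.strong_induction_on with
  | _ n ih =>
    have hs : gSum M q 1 n = digitSum q β n := by
      rw [gSum_eq_digitSum]
      exact digitSum_congr ih
    have key : Nat.findGreatest (fun m : ℕ => gSum M q 1 n + (m : ℝ) / q ^ (n + 1) ≤ 1) M
        = β n := by
      rw [Nat.findGreatest_eq_iff]
      refine ⟨h.digit_le n, fun _ => ?_, fun m hm hmM => ?_⟩
      · rw [hs, ← digitSum_succ]
        exact h.digitSum_le _
      · have h1 := h.one_lt n (lt_of_lt_of_le hm hmM)
        have h2 : ((β n : ℝ) + 1) / q ^ (n + 1) ≤ (m : ℝ) / q ^ (n + 1) := by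
          gcongr
          exact_mod_cast hm
        rw [hs]
        linarith
    rw [← key]
    unfold greedy gDigit
    congr

theorem IsGreedyOne.one_sub_le {M : ℕ} {q : ℝ} {β : ℕ → ℕ} (h : IsGreedyOne M q β)
    (hq : 1 < q) (hqM : q ≤ M + 1) (n : ℕ) : 1 - digitSum q β n ≤ M / (q - 1) / q ^ n := by
  have hq1 : 0 < q - 1 := sub_pos.mpr hq
  have hM1 : (1 : ℝ) ≤ M / (q - 1) := by rw [le_div_iff₀ hq1]; linarith
  have hq0 : 0 < q := by linarith
  induction n with
  | zero => simpa [digitSum_zero] using hM1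
  | succ n ih =>
    rw [digitSum_succ]
    rcases (h.digit_le n).lt_or_eq with hlt | heq
    · have h1 := h.one_lt n hlt
      have h2 : 1 / q ^ (n + 1) ≤ (M : ℝ) / (q - 1) / q ^ (n + 1) := by gcongr
      rw [add_div] at h1
      linarith
    · rw [heq]
      have h3 : (M : ℝ) / (q - 1) / q ^ n = M / (q - 1) / q ^ (n + 1) + M / q ^ (n + 1) := by
        field_simp
        ring
      linarith

theorem tendsto_const_div_pow_zero {q : ℝ} (hq : 1 < q) (C : ℝ) :
    Tendsto (fun n : ℕ => C / q ^ n) atTop (𝓝 0) :=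
  (tendsto_pow_atTop_atTop_of_one_lt hq).const_div_atTop C

/-- A sequence whose value in base `q` is bounded away from `1` from above precedes the
greedy expansion of `1`. -/
theorem IsGreedyOne.lexLt {M : ℕ} {q : ℝ} {β c : ℕ → ℕ} (h : IsGreedyOne M q β)
    (hq : 1 < q) (hqM : q ≤ M + 1) (hc : ∀ n, c n ≤ M) {y : ℝ} (hy : y < 1)
    (hcy : ∀ n, digitSum q c n ≤ y) : LexLt c β := by
  have hq0 : 0 < q := by linarith
  rcases lexLt_trichotomy c β with hlt | rfl | ⟨n, heq, hlt⟩
  · exact hlt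
  · exfalso
    have h0 : 1 - y ≤ 0 := ge_of_tendsto' (tendsto_const_div_pow_zero hq (M / (q - 1)))
      fun n => (sub_le_sub_left (hcy n) 1).trans (h.one_sub_le hq hqM n)
    linarith
  · exfalso
    have h1 := h.one_lt n (hlt.trans_le (hc n))
    have h2 : ((β n : ℝ) + 1) / q ^ (n + 1) ≤ (c n : ℝ) / q ^ (n + 1) := by
      gcongr
      exact_mod_cast hlt
    have h3 := hcy (n + 1)
    rw [digitSum_succ, ← digitSum_congr heq] at h3
    linarith

theorem IsGreedyOne.lexLt_shift {M : ℕ} {q : ℝ} {β : ℕ → ℕ} (h : IsGreedyOne M q β)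
    (hq : 1 < q) (hqM : q ≤ M + 1) {n : ℕ} (hn : β n < M) :
    LexLt (fun i => β (n + 1 + i)) β := by
  have hq0 : 0 < q := by linarith
  have hpow : 0 < q ^ (n + 1) := by positivity
  refine h.lexLt hq hqM (fun i => h.digit_le _)
    (y := (1 - digitSum q β (n + 1)) * q ^ (n + 1)) ?_ fun k => ?_
  · have h1 := h.one_lt n hn
    rw [add_div, ← add_assoc, ← digitSum_succ, ← sub_lt_iff_lt_add', lt_div_iff₀ hpow] at h1
    exact h1
  · have h1 := h.digitSum_le (n + 1 + k)
    rw [digitSum_add, ← le_sub_iff_add_le', div_le_iff₀ hpow] at h1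
    exact h1

theorem greedyOne_one (M : ℕ) : greedyOne M 1 = fun n => if n = 0 then 1 else 0 := by
  funext n
  simp [greedyOne]

theorem greedyOne_of_ne {q : ℝ} (M : ℕ) (hq : q ≠ 1) : greedyOne M q = greedy M q 1 := by
  funext n
  simp [greedyOne, hq]

theorem digitSum_greedyOne_le (M : ℕ) (q : ℝ) (n : ℕ) :
    digitSum q (greedyOne M q) n ≤ 1 := by
  by_cases hq : q = 1
  · subst hq
    rw [greedyOne_one]
    unfold digitSum
    simp only [one_pow, div_one, Nat.cast_ite, Nat.cast_one, Nat.cast_zero,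
      Finset.sum_ite_eq', Finset.mem_range]
    split_ifs <;> norm_num
  · rw [greedyOne_of_ne M hq]
    exact (isGreedyOne_greedy M q).digitSum_le n

theorem greedyOne_le {M : ℕ} (hM : 0 < M) (q : ℝ) (n : ℕ) : greedyOne M q n ≤ M := by
  by_cases hq : q = 1
  · subst hq
    rw [greedyOne_one]
    dsimp only
    split_ifs <;> omega
  · rw [greedyOne_of_ne M hq]
    exact (isGreedyOne_greedy M q).digit_le n

theorem one_le_greedyOne_zero {M : ℕ} (hM : 0 < M) {q : ℝ} (hq : 1 ≤ q) :
    1 ≤ greedyOne M q 0 := by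
  rcases hq.eq_or_lt with rfl | hq
  · simp [greedyOne_one]
  · rw [greedyOne_of_ne M hq.ne']
    by_contra! hlt
    have h0 : greedy M q 1 0 = 0 := by omega
    have h1 := (isGreedyOne_greedy M q).one_lt 0 (by omega)
    rw [h0, digitSum_zero] at h1
    have h2 : 1 / q < 1 := (div_lt_one (by linarith)).mpr hq
    norm_num at h1 h2
    linarith

theorem greedyOne_strictMono {M : ℕ} (hM : 0 < M) {q q' : ℝ} (hq : 1 ≤ q) (hlt : q < q')
    (hq' : q' ≤ M + 1) : LexLt (greedyOne M q) (greedyOne M q') := by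
  have hq0 : 0 < q := by linarith
  have hq1' : 1 < q' := by linarith
  have hβ0 : (0 : ℝ) < greedyOne M q 0 := by exact_mod_cast one_le_greedyOne_zero hM hq
  rw [greedyOne_of_ne M hq1'.ne']
  have hgap : (greedyOne M q 0 : ℝ) / q' < (greedyOne M q 0 : ℝ) / q := by gcongr
  refine (isGreedyOne_greedy M q').lexLt hq1' hq' (greedyOne_le hM q)
    (y := 1 - ((greedyOne M q 0 : ℝ) / q - (greedyOne M q 0 : ℝ) / q')) (by linarith)
    fun n => ?_
  have h1 := digitSum_mono (by linarith : 0 < q') (greedyOne M q) n.le_succ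
  have h2 := digitSum_add_gap_le hq0 hlt.le (greedyOne M q) n
  have h3 := digitSum_greedyOne_le M q (n + 1)
  linarith

theorem digitSum_le_one_sub {M : ℕ} {β : ℕ → ℕ} (hβ : ∀ i, β i ≤ M) (n : ℕ) :
    digitSum ((M : ℝ) + 1) β n ≤ 1 - 1 / ((M : ℝ) + 1) ^ n := by
  induction n with
  | zero => simp [digitSum_zero]
  | succ n ih =>
    rw [digitSum_succ]
    have h1 : (β n : ℝ) / ((M : ℝ) + 1) ^ (n + 1) ≤ M / ((M : ℝ) + 1) ^ (n + 1) := by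
      gcongr
      exact hβ n
    have h2 : 1 / ((M : ℝ) + 1) ^ n
        = M / ((M : ℝ) + 1) ^ (n + 1) + 1 / ((M : ℝ) + 1) ^ (n + 1) := by
      field_simp
      ring
    linarith

theorem summable_const_div_pow_succ {q : ℝ} (hq : 1 < q) (C : ℝ) :
    Summable fun i : ℕ => C / q ^ (i + 1) := by
  have h := (summable_geometric_of_lt_one (inv_nonneg.mpr (by linarith : 0 ≤ q))
    (inv_lt_one_of_one_lt₀ hq)).mul_left (C / q)
  refine h.congr fun i => ?_
  rw [inv_pow, pow_succ]
  field_simp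

/-- Every digit sequence whose digit sum exceeds `1` is an expansion of `1` in some base. -/
theorem exists_tendsto_digitSum {M : ℕ} (hM : 0 < M) {β : ℕ → ℕ} (hβ : ∀ i, β i ≤ M) {N : ℕ}
    (hN : 1 < digitSum 1 β N) :
    ∃ q : ℝ, 1 < q ∧ q ≤ M + 1 ∧ Tendsto (digitSum q β) atTop (𝓝 1) := by
  have hM' : (0 : ℝ) < M := by exact_mod_cast hM
  have hcont : ContinuousAt (fun q : ℝ => digitSum q β N) 1 := by
    unfold digitSum
    refine tendsto_finsetSum _ fun i _ => ?_
    exact ContinuousAt.div continuousAt_const (by fun_prop) (by simp)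
  obtain ⟨a, ha, ha1, haM⟩ : ∃ a : ℝ, 1 < digitSum a β N ∧ 1 < a ∧ a < M + 1 := by
    have h1 : ∀ᶠ a in 𝓝[>] (1 : ℝ), 1 < digitSum a β N :=
      (hcont.eventually (lt_mem_nhds hN)).filter_mono nhdsWithin_le_nhds
    have h2 : ∀ᶠ a in 𝓝[>] (1 : ℝ), a ∈ Set.Ioo 1 ((M : ℝ) + 1) :=
      Ioo_mem_nhdsGT (by linarith)
    exact (h1.and h2).exists
  have hsum : ∀ q : ℝ, 1 < q → Summable fun i => (β i : ℝ) / q ^ (i + 1) := fun q hq => by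
    have hq0 : 0 < q := by linarith
    refine (summable_const_div_pow_succ hq M).of_nonneg_of_le (fun i => by positivity)
      fun i => ?_
    gcongr
    exact hβ i
  have hcts : ContinuousOn (fun q : ℝ => ∑' i, (β i : ℝ) / q ^ (i + 1))
      (Set.Icc a ((M : ℝ) + 1)) := by
    refine continuousOn_tsum (fun i => ?_) (summable_const_div_pow_succ ha1 M)
      fun i q hq => ?_
    · refine ContinuousOn.div continuousOn_const (by fun_prop) fun q hq => ?_
      have : 0 < q := by linarith [hq.1]
      positivity
    · have hq0 : 0 < q := by linarith [hq.1]
      rw [Real.norm_of_nonneg (by positivity)]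
      have h1 := hq.1
      have h2 : (β i : ℝ) ≤ M := by exact_mod_cast hβ i
      gcongr
  obtain ⟨q, hq, hq1⟩ := intermediate_value_Icc' haM.le hcts (show (1 : ℝ) ∈ Set.Icc _ _ from
    ⟨(hsum _ (by linarith)).tsum_le_of_sum_range_le fun n =>
        (digitSum_le_one_sub hβ n).trans (sub_le_self _ (by positivity)),
      ha.le.trans ((hsum a ha1).sum_le_tsum _ fun i _ => by positivity)⟩)
  have hq1' : 1 < q := ha1.trans_le hq.1
  refine ⟨q, hq1', hq.2, ?_⟩
  have := (hsum q hq1').hasSum.tendsto_sum_nat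
  dsimp only at hq1
  rwa [hq1] at this

theorem digitSum_le_of_digit_le {M : ℕ} {q : ℝ} (hq : 1 < q) {c : ℕ → ℕ}
    (hc : ∀ i, c i ≤ M) (n : ℕ) : digitSum q c n ≤ M / (q - 1) := by
  have hq0 : 0 < q := by linarith
  have hq1 : 0 < q - 1 := sub_pos.mpr hq
  have h : digitSum q c n ≤ M / (q - 1) - M / (q - 1) / q ^ n := by
    induction n with
    | zero => simp [digitSum_zero]
    | succ n ih =>
      rw [digitSum_succ]
      have h1 : (c n : ℝ) / q ^ (n + 1) ≤ M / q ^ (n + 1) := by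
        gcongr
        exact hc n
      have h2 : (M : ℝ) / (q - 1) / q ^ n
          = M / (q - 1) / q ^ (n + 1) + M / q ^ (n + 1) := by
        field_simp
        ring
      linarith
  exact h.trans (sub_le_self _ (by positivity))

/-- An expansion of `1` all of whose shifts after a non-maximal digit precede it is greedy. -/
theorem isGreedyOne_of_lexLt_shift {M : ℕ} {q : ℝ} (hq : 1 < q) {β : ℕ → ℕ}
    (hβ : ∀ i, β i ≤ M) (hlex : ∀ n, β n < M → LexLt (fun i => β (n + 1 + i)) β)
    (hlim : Tendsto (digitSum q β) atTop (𝓝 1)) : IsGreedyOne M q β := by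
  have hq0 : 0 < q := by linarith
  have hmono := digitSum_mono hq0 β
  have hle : ∀ n, digitSum q β n ≤ 1 := fun n => hmono.ge_of_tendsto hlim n
  set r : ℕ → ℝ := fun n => (1 - digitSum q β n) * q ^ n with hr
  have hr_add : ∀ n k, r n = digitSum q (fun i => β (n + i)) k + r (n + k) / q ^ k := by
    intro n k
    simp only [hr, digitSum_add, pow_add]
    field_simp
    ring
  have hr_le : ∀ n, r n ≤ M / (q - 1) := by
    intro n
    have h1 : Tendsto (fun k => (digitSum q β (n + k) - digitSum q β n) * q ^ n) atTop
        (𝓝 (r n)) :=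
      ((hlim.comp (tendsto_add_atTop_nat n)).congr fun k => by
        simp [add_comm]).sub_const _ |>.mul_const _
    refine le_of_tendsto' h1 fun k => ?_
    rw [digitSum_add, add_sub_cancel_left, div_mul_cancel₀ _ (by positivity)]
    exact digitSum_le_of_digit_le hq (fun i => hβ _) k
  have hstep : ∀ n, β n < M → ∃ m, β (n + 1 + m) < M ∧
      r (n + 1) ≤ digitSum q β (m + 1) + (r (n + 1 + m + 1) - 1) / q ^ (m + 1) := by
    intro n hn
    obtain ⟨m, heq, hlt⟩ := hlex n hn
    refine ⟨m, hlt.trans_le (hβ m), ?_⟩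
    rw [hr_add (n + 1) (m + 1), digitSum_succ, digitSum_succ, digitSum_congr heq]
    have h1 : (β (n + 1 + m) : ℝ) / q ^ (m + 1) ≤ ((β m : ℝ) - 1) / q ^ (m + 1) := by
      gcongr
      rw [le_sub_iff_add_le]
      exact_mod_cast hlt
    rw [sub_div] at h1 ⊢
    rw [← add_assoc (n + 1) m 1]
    linarith
  have hbound : ∀ k n, β n < M → r (n + 1) - 1 ≤ M / (q - 1) / q ^ k := by
    intro k
    induction k with
    | zero => intro n _; rw [pow_zero, div_one]; linarith [hr_le (n + 1)]
    | succ k ih =>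
      intro n hn
      obtain ⟨m, hm, hrm⟩ := hstep n hn
      have h1 : (r (n + 1 + m + 1) - 1) / q ^ (m + 1) ≤ M / (q - 1) / q ^ (k + 1) :=
        calc (r (n + 1 + m + 1) - 1) / q ^ (m + 1)
            ≤ M / (q - 1) / q ^ k / q ^ (m + 1) := by gcongr; exact ih _ hm
          _ ≤ M / (q - 1) / q ^ k / q ^ 1 := by
              have hq1 : 0 < q - 1 := sub_pos.mpr hq
              have := hq.le
              gcongr
              omega
          _ = M / (q - 1) / q ^ (k + 1) := by rw [div_div _ (q ^ k), ← pow_add]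
      linarith [hle (m + 1)]
  have hr_one : ∀ n, β n < M → r (n + 1) ≤ 1 := fun n hn =>
    sub_nonpos.mp (ge_of_tendsto' (tendsto_const_div_pow_zero hq (M / (q - 1)))
      fun k => hbound k n hn)
  refine ⟨hβ, hle, fun n hn => ?_⟩
  have hpow : 0 < q ^ (n + 1) := by positivity
  suffices h : r (n + 1) < 1 by
    rw [add_div, ← add_assoc, ← digitSum_succ, ← sub_lt_iff_lt_add', lt_div_iff₀ hpow]
    exact h
  refine lt_of_le_of_ne (hr_one n hn) fun heq => ?_
  obtain ⟨m, hm, hrm⟩ := hstep n hn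
  have hpowm : 0 < q ^ (m + 1) := by positivity
  have h1 : (r (n + 1 + m + 1) - 1) / q ^ (m + 1) ≤ 0 :=
    div_nonpos_of_nonpos_of_nonneg (by linarith [hr_one _ hm]) hpowm.le
  have h2 : digitSum q β (m + 1) = 1 := le_antisymm (hle _) (by linarith)
  have h3 : r (n + 1 + m + 1) = 0 := by
    have : digitSum q β (n + 1 + m + 1) = 1 :=
      le_antisymm (hle _) (h2 ▸ hmono (by omega))
    simp [hr, this]
  rw [h2, h3, heq] at hrm
  have h4 : (0 - 1) / q ^ (m + 1) < 0 := div_neg_of_neg_of_pos (by norm_num) hpowm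
  linarith

theorem one_le_digit_zero_of_lexLt_shift {β : ℕ → ℕ} (h : LexLt (fun i => β (0 + 1 + i)) β) :
    1 ≤ β 0 := by
  obtain ⟨n, heq, hlt⟩ := h
  by_contra! h0
  have hzero : ∀ k, k ≤ n → β k = 0 := by
    intro k
    induction k with
    | zero => intro _; omega
    | succ k ih =>
      intro hk
      have h1 : β (k + 1) = β k := by
        simpa only [zero_add, add_comm] using heq k (by omega)
      rw [h1]
      exact ih (by omega)
  have h2 := hzero n le_rfl
  omega

theorem exists_one_lt_digitSum_one {β : ℕ → ℕ} (h0 : 1 ≤ β 0)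
    (hne : β ≠ fun n => if n = 0 then 1 else 0) : ∃ N, 1 < digitSum 1 β N := by
  have h0' : (1 : ℝ) ≤ β 0 := by exact_mod_cast h0
  by_contra! hle
  refine hne (funext fun n => ?_)
  have h1 := hle 1
  simp only [digitSum, Finset.sum_range_one, one_pow, div_one] at h1
  rcases Nat.eq_zero_or_pos n with rfl | hn
  · simp only [if_true]
    exact_mod_cast le_antisymm h1 h0'
  · have h2 := hle (n + 1)
    have h3 := digitSum_mono one_pos β hn
    rw [digitSum_succ] at h2
    simp only [digitSum, Nat.succ_eq_add_one, zero_add, Finset.sum_range_one, one_pow,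
      div_one] at h2 h3
    rw [if_neg hn.ne']
    have h4 : (β n : ℝ) ≤ 0 := by linarith
    exact Nat.le_zero.mp (by exact_mod_cast h4)

/-- Theorem 3.2 (a): `q ↦ (β_i)`, the greedy expansion of `1` in base `q` (with the
convention `(β_i) = 10^∞` for `q = 1`), is a strictly increasing one-to-one correspondence
between `[1, M+1]` and the set of all sequences with digits in `{0,…,M}` satisfying
`β_{n+1}β_{n+2}… < β_1β_2…` whenever `β_n < M`. -/
theorem greedy_one_bijection (M : ℕ) (hM : 0 < M) :
    (∀ q q' : ℝ, 1 ≤ q → q < q' → q' ≤ (M : ℝ) + 1 →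
      LexLt (greedyOne M q) (greedyOne M q')) ∧
    Set.BijOn (fun q : ℝ => greedyOne M q) (Set.Icc 1 ((M : ℝ) + 1))
      {β : ℕ → ℕ | (∀ i, β i ≤ M) ∧
        ∀ n, β n < M → LexLt (fun i => β (n + 1 + i)) β} := by
  refine ⟨fun q q' hq hlt hq' => greedyOne_strictMono hM hq hlt hq', ?_, ?_, ?_⟩
  · rintro q ⟨hq, hqM⟩
    refine ⟨greedyOne_le hM q, fun n hn => ?_⟩
    dsimp only at hn ⊢
    rcases hq.eq_or_lt with rfl | hq
    · exact ⟨0, fun k hk => absurd hk k.not_lt_zero, by simp [greedyOne_one]⟩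
    · rw [greedyOne_of_ne M hq.ne'] at hn ⊢
      exact (isGreedyOne_greedy M q).lexLt_shift hq hqM hn
  · intro q hq q' hq' heq
    dsimp only at heq
    rcases lt_trichotomy q q' with hlt | h | hlt
    · exact absurd (heq ▸ greedyOne_strictMono hM hq.1 hlt hq'.2) (lexLt_irrefl _)
    · exact h
    · exact absurd (heq ▸ greedyOne_strictMono hM hq'.1 hlt hq.2) (lexLt_irrefl _)
  · rintro β ⟨hβ, hlex⟩
    have h0 : 1 ≤ β 0 := by
      by_contra! h
      exact h.not_ge (one_le_digit_zero_of_lexLt_shift (hlex 0 (by omega)))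
    by_cases hone : β = fun n => if n = 0 then 1 else 0
    · exact ⟨1, ⟨le_rfl, by simp⟩, by rw [hone]; exact greedyOne_one M⟩
    · obtain ⟨N, hN⟩ := exists_one_lt_digitSum_one h0 hone
      obtain ⟨q, hq, hqM, hlim⟩ := exists_tendsto_digitSum hM hβ hN
      refine ⟨q, ⟨hq.le, hqM⟩, ?_⟩
      dsimp only
      rw [greedyOne_of_ne M hq.ne']
      exact (isGreedyOne_of_lexLt_shift hq hβ hlex hlim).eq_greedy (by linarith)
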